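/- arXiv:2509.16458 — 3 statements merged into one kernel-verified Lean document; each statement's English description precedes it below -/
import Mathlib

section
/- Let n ≥ 1, let r > 0, and set r' = r/(2√n). Let e_1,…,e_n be the standard basis of ℝⁿ. Suppose q_1,…,q_{2n} ∈ ℝⁿ satisfy ‖q_i − r·e_i‖ < r' for 1 ≤ i ≤ n and ‖q_{n+i} + r·e_i‖ < r' for 1 ≤ i ≤ n. Then the closed ball of radius r' centered at the origin is contained in the convex hull of {q_1,…,q_{2n}}. -/
/-- Some coordinate of a Euclidean vector is at least the norm divided by `√n` in absolute value. -/
theorem EuclideanSpace.exists_norm_le_sqrt_mul_abs {n : ℕ} (hn : 1 ≤ n)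
    (v : EuclideanSpace ℝ (Fin n)) : ∃ i, ‖v‖ ≤ Real.sqrt n * |v i| := by
  have : Nonempty (Fin n) := ⟨⟨0, hn⟩⟩
  obtain ⟨i, hi⟩ := Finite.exists_max fun i => |v i|
  refine ⟨i, ?_⟩
  rw [EuclideanSpace.norm_eq, ← Real.sqrt_sq (abs_nonneg (v i)), ← Real.sqrt_mul n.cast_nonneg]
  apply Real.sqrt_le_sqrt
  calc ∑ j, ‖v j‖ ^ 2 ≤ ∑ _j : Fin n, |v i| ^ 2 := by
        gcongr with j
        exact hi j
    _ = n * |v i| ^ 2 := by simp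

/-- If `q i` is within `r' = r/(2√n)` of `r • e i` and `q' i` is within `r'`
of `-r • e i` for each `i`, then the closed ball of radius `r'` about the origin is contained
in the convex hull of the `2n` points `q i, q' i`. -/
theorem stmt_2 (n : ℕ) (hn : 1 ≤ n) (r r' : ℝ) (hr : 0 < r)
    (hr' : r' = r / (2 * Real.sqrt n))
    (q q' : Fin n → EuclideanSpace ℝ (Fin n))
    (hq : ∀ i, ‖q i - r • EuclideanSpace.single i (1 : ℝ)‖ < r')
    (hq' : ∀ i, ‖q' i + r • EuclideanSpace.single i (1 : ℝ)‖ < r') :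
    Metric.closedBall (0 : EuclideanSpace ℝ (Fin n)) r' ⊆
      convexHull ℝ (Set.range q ∪ Set.range q') := by
  intro x hx
  by_contra hxK
  have hclosed : IsClosed (convexHull ℝ (Set.range q ∪ Set.range q')) :=
    ((Set.finite_range q).union (Set.finite_range q')).isClosed_convexHull ℝ
  obtain ⟨f, u, hfu, hux⟩ :=
    geometric_hahn_banach_closed_point (convex_convexHull ℝ _) hclosed hxK
  obtain ⟨v, rfl⟩ := (InnerProductSpace.toDual ℝ (EuclideanSpace ℝ (Fin n))).surjective f
  simp only [InnerProductSpace.toDual_apply_apply] at hfu hux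
  obtain ⟨i, hi⟩ := EuclideanSpace.exists_norm_le_sqrt_mul_abs hn v
  have hs : 0 < Real.sqrt n := Real.sqrt_pos.2 (by exact_mod_cast hn)
  have hr'pos : 0 < r' := hr' ▸ by positivity
  have hrr : r = 2 * r' * Real.sqrt n := by
    rw [hr']
    field_simp
  have hvi : 2 * r' * ‖v‖ ≤ r * |v i| := by
    rw [hrr, mul_assoc (2 * r')]
    gcongr
  have hvx : inner ℝ v x ≤ r' * ‖v‖ := by
    rw [mem_closedBall_zero_iff] at hx
    nlinarith [real_inner_le_norm v x, norm_nonneg v]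
  have hqi := hfu (q i) (subset_convexHull ℝ _ (Or.inl ⟨i, rfl⟩))
  have hqi' := hfu (q' i) (subset_convexHull ℝ _ (Or.inr ⟨i, rfl⟩))
  have hd := (abs_le.1 (abs_real_inner_le_norm v (q i - r • EuclideanSpace.single i (1 : ℝ)))).1
  have hd' := (abs_le.1 (abs_real_inner_le_norm v (q' i + r • EuclideanSpace.single i (1 : ℝ)))).1
  have hb := mul_le_mul_of_nonneg_left (hq i).le (norm_nonneg v)
  have hb' := mul_le_mul_of_nonneg_left (hq' i).le (norm_nonneg v)
  have hvs : inner ℝ v (EuclideanSpace.single i (1 : ℝ)) = v i := by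
    simp [EuclideanSpace.inner_single_right]
  rw [inner_sub_right, real_inner_smul_right, hvs] at hd
  rw [inner_add_right, real_inner_smul_right, hvs] at hd'
  rcases abs_cases (v i) with ⟨h, -⟩ | ⟨h, -⟩ <;> rw [h] at hvi <;> linarith
end

section
/- Let K be a field and R = ⊕_{m∈ℕ} R_m an ℕ-graded commutative K-algebra which is an integral domain, such that R_m ≠ 0 for all sufficiently large m. Let F be a multiplicative filtration on R, and for each m ≥ 1 set T_m(F) := (1/m)·sup{λ ≥ 0 : F^λ R_m ≠ 0} (with T_m(F) := 0 if R_m = 0), and T(F) := sup_{m ≥ 1} T_m(F). Assume F is linearly bounded, i.e. T(F) < ∞. Then lim_{m→∞} T_m(F) exists and equals T(F). -/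
/-- In a multiplicative filtration with `1 ∈ F 0 0`, powers of an element of `F m l` lie in the
corresponding multiples of the indices. -/
theorem pow_mem_of_multiplicative {K R : Type*} [Field K] [CommRing R] [Algebra K R]
    {F : ℕ → ℝ → Submodule K R} (hone : (1 : R) ∈ F 0 0)
    (hmul : ∀ (m m' : ℕ) (l l' : ℝ) (x y : R),
      x ∈ F m l → y ∈ F m' l' → x * y ∈ F (m + m') (l + l'))
    {m : ℕ} {l : ℝ} {x : R} (hx : x ∈ F m l) (q : ℕ) : x ^ q ∈ F (q * m) (q * l) := by
  induction q with
  | zero => simpa using hone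
  | succ q ih =>
    have h := hmul _ _ _ _ _ _ ih hx
    rw [pow_succ, Nat.succ_mul, Nat.cast_succ, add_one_mul]
    exact h

/-- **Fekete's lemma for linearly bounded multiplicative filtrations.**
Let `R` be an `ℕ`-graded commutative `K`-algebra which is an integral domain, with graded
pieces `𝒜 m` nonzero for all sufficiently large `m`.  Let `F` be a multiplicative filtration
on `R`, and for `m ≥ 1` let `T_m(F) = (1/m) sup {λ ≥ 0 : F^λ R_m ≠ 0}` (equal to `0` when
`R_m = 0`).  If `F` is linearly bounded, i.e. `T(F) = sup_{m ≥ 1} T_m(F) < ∞`, then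
`T_m(F) → T(F)` as `m → ∞`. -/
theorem stmt_6 (K R : Type*) [Field K] [CommRing R] [IsDomain R] [Algebra K R]
    (𝒜 : ℕ → Submodule K R) [GradedAlgebra 𝒜]
    (hbig : ∃ M : ℕ, ∀ m ≥ M, 𝒜 m ≠ ⊥)
    (F : ℕ → ℝ → Submodule K R)
    (hsub : ∀ (m : ℕ) (l : ℝ), F m l ≤ 𝒜 m)
    (hdec : ∀ (m : ℕ) (l l' : ℝ), l' < l → F m l ≤ F m l')
    (hzero : ∀ m : ℕ, F m 0 = 𝒜 m)
    (hbdd : ∀ m : ℕ, ∃ Λ : ℝ, ∀ l ≥ Λ, F m l = ⊥)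
    (hmul : ∀ (m m' : ℕ) (l l' : ℝ) (x y : R),
      x ∈ F m l → y ∈ F m' l' → x * y ∈ F (m + m') (l + l'))
    (Tm : ℕ → ℝ)
    (hTm0 : ∀ m : ℕ, 𝒜 m = ⊥ → Tm m = 0)
    (hTm1 : ∀ m : ℕ, 𝒜 m ≠ ⊥ → Tm m = sSup {l : ℝ | 0 ≤ l ∧ F m l ≠ ⊥} / m)
    (hlin : BddAbove {x : ℝ | ∃ m : ℕ, 1 ≤ m ∧ Tm m = x}) :
    Filter.Tendsto Tm Filter.atTop
      (nhds (sSup {x : ℝ | ∃ m : ℕ, 1 ≤ m ∧ Tm m = x})) := by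
  obtain ⟨M, hM⟩ := hbig
  have bdd (n : ℕ) : BddAbove {l : ℝ | 0 ≤ l ∧ F n l ≠ ⊥} := by
    obtain ⟨Λ, hΛ⟩ := hbdd n
    refine ⟨Λ, fun l hl => ?_⟩
    by_contra! h
    exact hl.2 (hΛ l h.le)
  have hnonneg (n : ℕ) : 0 ≤ Tm n := by
    by_cases h : 𝒜 n = ⊥
    · exact (hTm0 n h).ge
    · rw [hTm1 n h]
      exact div_nonneg (Real.sSup_nonneg fun l hl => hl.1) n.cast_nonneg
  refine tendsto_order.2 ⟨fun c hc => ?_, fun c hc => ?_⟩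
  · obtain hc0 | hc0 := lt_or_ge c 0
    · exact .of_forall fun n => hc0.trans_le (hnonneg n)
    obtain ⟨_, ⟨m, hm, rfl⟩, hcm⟩ := exists_lt_of_lt_csSup (by exact ⟨_, 1, le_rfl, rfl⟩) hc
    have hA : 𝒜 m ≠ ⊥ := fun h => (hc0.trans_lt hcm).ne' (hTm0 m h)
    have hm0 : (0 : ℝ) < m := by exact_mod_cast hm
    rw [hTm1 m hA, lt_div_iff₀ hm0] at hcm
    obtain ⟨l, ⟨hl0, hl⟩, hcl⟩ :=
      exists_lt_of_lt_csSup (by exact ⟨0, le_rfl, by rwa [hzero]⟩) hcm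
    obtain ⟨x, hx, hx0⟩ := Submodule.exists_mem_ne_zero_of_ne_bot hl
    have hone : (1 : R) ∈ F 0 0 := by
      rw [hzero]
      exact SetLike.one_mem_graded 𝒜
    obtain ⟨N, hN⟩ := exists_nat_gt (l * (M + m) / (l - c * m))
    rw [div_lt_iff₀ (sub_pos.2 hcl)] at hN
    filter_upwards [Filter.eventually_ge_atTop (N + M + 1)] with n hn
    set q := (n - M) / m
    set r := (n - M) % m
    have hdiv : q * m + r = n - M := Nat.div_add_mod' _ _
    have hr : r < m := Nat.mod_lt _ hm
    have hnq : q * m + (M + r) = n := by omega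
    obtain ⟨y, hy, hy0⟩ := Submodule.exists_mem_ne_zero_of_ne_bot (hM (M + r) (by omega))
    rw [← hzero] at hy
    have hxy := hmul _ _ _ _ _ _ (pow_mem_of_multiplicative hone hmul hx q) hy
    rw [hnq, add_zero] at hxy
    have hS : q * l ≤ sSup {l : ℝ | 0 ≤ l ∧ F n l ≠ ⊥} :=
      le_csSup (bdd n) ⟨by positivity, fun h =>
        mul_ne_zero (pow_ne_zero q hx0) hy0 ((Submodule.mem_bot K).1 (h ▸ hxy))⟩
    have hn0 : (0 : ℝ) < n := by exact_mod_cast (by omega : 0 < n)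
    rw [hTm1 n (hM n (by omega)), lt_div_iff₀ hn0]
    refine lt_of_lt_of_le ?_ hS
    have hqn : (q : ℝ) * m + (M + r) = n := by exact_mod_cast hnq
    have hr' : (r : ℝ) ≤ m := by exact_mod_cast hr.le
    have hNn : (N : ℝ) ≤ n := by exact_mod_cast (by omega : N ≤ n)
    have h1 : l * (M + m) < n * (l - c * m) :=
      hN.trans_le (mul_le_mul_of_nonneg_right hNn (sub_pos.2 hcl).le)
    have h2 : l * r ≤ l * m := mul_le_mul_of_nonneg_left hr' hl0
    refine lt_of_mul_lt_mul_right ?_ hm0.le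
    have h3 : l * (q * m + (M + r)) = l * n := by rw [hqn]
    linarith
  · filter_upwards [Filter.eventually_ge_atTop 1] with n hn
    exact (le_csSup hlin ⟨n, hn, rfl⟩).trans_lt hc
end

section
/- Let (d_n)_{n∈ℤ} be the two-sided integer sequence with d_0 = d_1 = 1 and d_{n+1} = 3d_n − d_{n−1} for all n ∈ ℤ. Then for every irrational real number x with (7−3√5)/2 < x < (7+3√5)/2, there exists n ∈ ℤ such that d_{n+1}/d_{n−1} < x < d_{n+2}/d_n. -/
theorem one_le_and_le_succ_and_natCast_le {d : ℤ → ℤ} (h0 : d 0 = 1) (h1 : d 1 = 1)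
    (hrec : ∀ n : ℤ, d (n + 2) = 3 * d (n + 1) - d n) (k : ℕ) :
    1 ≤ d k ∧ d k ≤ d (k + 1) ∧ (k : ℤ) ≤ d (k + 1) := by
  induction k with
  | zero => simp [h0, h1]
  | succ k ih =>
    have h := hrec k
    push_cast
    rw [add_assoc, one_add_one_eq_two]
    omega

theorem reflection_natCast {d : ℤ → ℤ} (h0 : d 0 = 1) (h1 : d 1 = 1)
    (hrec : ∀ n : ℤ, d (n + 2) = 3 * d (n + 1) - d n) (k : ℕ) :
    d (1 - k) = d k ∧ d (-k) = d (k + 1) := by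
  induction k with
  | zero => simp [h0, h1]
  | succ k ih =>
    have h := hrec k
    have h' := hrec (-k - 1)
    rw [show -(k : ℤ) - 1 + 2 = 1 - k by ring, show -(k : ℤ) - 1 + 1 = -k by ring] at h'
    push_cast
    rw [show (1 : ℤ) - (k + 1) = -k by ring, show -((k : ℤ) + 1) = -k - 1 by ring,
      add_assoc, one_add_one_eq_two]
    omega

theorem sub_mul_mem_Icc {d : ℤ → ℤ} (h0 : d 0 = 1) (h1 : d 1 = 1)
    (hrec : ∀ n : ℤ, d (n + 2) = 3 * d (n + 1) - d n) {l : ℝ} (hl : l ^ 2 = 3 * l - 1)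
    (hl2 : 2 ≤ l) (hl3 : l ≤ 3) (k : ℕ) :
    (d (k + 1) - l * d k : ℝ) ∈ Set.Icc (1 - l) 0 := by
  induction k with
  | zero => simp [h0, h1]; linarith
  | succ k ih =>
    have h : (d (k + 2) : ℝ) = 3 * d (k + 1) - d k := by exact_mod_cast hrec k
    push_cast
    rw [add_assoc, one_add_one_eq_two, h]
    have e : (3 * d (k + 1) - d k - l * d (k + 1) : ℝ) =
        (3 - l) * (d (k + 1) - l * d k) := by
      linear_combination (-(d k : ℝ)) * hl
    rw [e]
    obtain ⟨ha, hb⟩ := ih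
    constructor
    · nlinarith
    · exact mul_nonpos_of_nonneg_of_nonpos (by linarith) hb

theorem exists_lt_div {d : ℤ → ℤ} (h0 : d 0 = 1) (h1 : d 1 = 1)
    (hrec : ∀ n : ℤ, d (n + 2) = 3 * d (n + 1) - d n) {y : ℝ}
    (hy : y < (7 + 3 * Real.sqrt 5) / 2) :
    ∃ k : ℕ, y < (d (k + 2) : ℝ) / d k := by
  have hs : Real.sqrt 5 ^ 2 = 5 := Real.sq_sqrt (by norm_num)
  have hs2 : 2 ≤ Real.sqrt 5 := Real.le_sqrt_of_sq_le (by norm_num)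
  have hs3 : Real.sqrt 5 ≤ 3 := Real.sqrt_le_iff.2 (by norm_num)
  obtain ⟨l, hl⟩ : ∃ l : ℝ, l = (3 + Real.sqrt 5) / 2 := ⟨_, rfl⟩
  have hll : l ^ 2 = 3 * l - 1 := by rw [hl]; linear_combination hs / 4
  have hy' : 0 < l ^ 2 - y := by rw [hll, hl]; linarith
  have hl2 : 2 ≤ l := by linarith
  have hl3 : l ≤ 3 := by linarith
  obtain ⟨m, hm⟩ := exists_nat_gt (8 / (l ^ 2 - y))
  rw [div_lt_iff₀ hy'] at hm
  refine ⟨m + 1, ?_⟩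
  have hpos := (one_le_and_le_succ_and_natCast_le h0 h1 hrec (m + 1)).1
  have hge := (one_le_and_le_succ_and_natCast_le h0 h1 hrec m).2.2
  have ha := (sub_mul_mem_Icc h0 h1 hrec hll hl2 hl3 (m + 1)).1
  have hb := (sub_mul_mem_Icc h0 h1 hrec hll hl2 hl3 (m + 2)).1
  push_cast at *
  rw [show (m : ℤ) + 2 + 1 = m + 1 + 2 by ring, show (m : ℤ) + 2 = m + 1 + 1 by ring] at hb
  have hpos' : (1 : ℝ) ≤ d (m + 1) := by exact_mod_cast hpos
  have hge' : (m : ℝ) ≤ d (m + 1) := by exact_mod_cast hge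
  rw [lt_div_iff₀ (by linarith)]
  have hc : l * (1 - l) ≤ l * (d (m + 1 + 1) - l * d (m + 1)) :=
    mul_le_mul_of_nonneg_left ha (by linarith)
  have hd : (m : ℝ) * (l ^ 2 - y) ≤ d (m + 1) * (l ^ 2 - y) :=
    mul_le_mul_of_nonneg_right hge' hy'.le
  nlinarith

/-- For the two-sided integer sequence with `d 0 = d 1 = 1` and
`d (n+1) = 3 d n − d (n−1)`: every irrational real `x` with
`(7 − 3√5)/2 < x < (7 + 3√5)/2` satisfies `d (n+1)/d (n−1) < x < d (n+2)/d n` for some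
`n ∈ ℤ`. -/
theorem stmt_13 (d : ℤ → ℤ) (h0 : d 0 = 1) (h1 : d 1 = 1)
    (hrec : ∀ n : ℤ, d (n + 1) = 3 * d n - d (n - 1))
    (x : ℝ) (hx : Irrational x)
    (hlo : (7 - 3 * Real.sqrt 5) / 2 < x) (hhi : x < (7 + 3 * Real.sqrt 5) / 2) :
    ∃ n : ℤ, (d (n + 1) : ℝ) / (d (n - 1) : ℝ) < x ∧
      x < (d (n + 2) : ℝ) / (d n : ℝ) := by
  have hrec' : ∀ n : ℤ, d (n + 2) = 3 * d (n + 1) - d n := fun n => by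
    simpa [add_assoc] using hrec (n + 1)
  have hs : Real.sqrt 5 ^ 2 = 5 := Real.sq_sqrt (by norm_num)
  have hs0 : 0 ≤ Real.sqrt 5 := Real.sqrt_nonneg 5
  have hx0 : 0 < x := by nlinarith
  have hinv : x⁻¹ < (7 + 3 * Real.sqrt 5) / 2 := by
    rw [inv_lt_iff_one_lt_mul₀ hx0]
    nlinarith
  obtain ⟨a, ha⟩ := exists_lt_div h0 h1 hrec' hinv
  obtain ⟨b, hb⟩ := exists_lt_div h0 h1 hrec' hhi
  have hstart : (d (-a + 1) : ℝ) / d (-a - 1) < x := by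
    have e₁ : d (-a + 1) = d a := by
      rw [neg_add_eq_sub]
      exact (reflection_natCast h0 h1 hrec' a).1
    have e₂ : d (-a - 1) = d (a + 2) := by
      have h := (reflection_natCast h0 h1 hrec' (a + 1)).2
      push_cast at h
      rwa [neg_add, ← sub_eq_add_neg, add_assoc, one_add_one_eq_two] at h
    rw [e₁, e₂, ← inv_div]
    exact inv_lt_of_inv_lt₀ hx0 ha
  by_contra! hnone
  have hall : ∀ j : ℕ, (d (-a + j + 1) : ℝ) / d (-a + j - 1) < x := by
    intro j
    induction j with
    | zero => simpa using hstart
    | succ j ih =>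
      have h := hnone _ ih
      push_cast
      rw [show -(a : ℤ) + (j + 1) + 1 = -a + j + 2 by ring,
        show -(a : ℤ) + (j + 1) - 1 = -a + j by ring]
      refine lt_of_le_of_ne h fun he => hx ⟨(d (-a + j + 2) : ℚ) / d (-a + j), ?_⟩
      push_cast
      exact he
  have h := hall (a + b + 1)
  push_cast at h
  rw [show -(a : ℤ) + (a + b + 1) + 1 = b + 2 by ring,
    show -(a : ℤ) + (a + b + 1) - 1 = b by ring] at h
  exact lt_asymm h hb
end
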